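/- Let A_0, A_1, …, A_L be deterministic finite automata over a common alphabet Σ such that A_0 has exactly one accepting state, that accepting state is deadlock, and each A_i (i ∈ [1,L]) is deadlock-free and has all states accepting. Let S be the deterministic deadlock-free FSA constructed from them as described in the context, with faulty event set T_f = {F} and local observers O = {O_1, …, O_L}. Then there exists a word w ∈ Σ* accepted by every A_i, i ∈ [0,L], if and only if S is not (O, T_f)-co-predictable. -/

import Mathlib

namespace DES

/-- Run of a labelled transition system along a finite word of events. -/
inductive RunRel {S : Type*} {E : Type*} (δ : S → E → S → Prop) : S → List E → S → Prop
  | nil (x : S) : RunRel δ x [] x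
  | cons {x y z : S} {e : E} {w : List E} :
      δ x e y → RunRel δ y w z → RunRel δ x (e :: w) z

/-- A labelling function (with `none` playing the role of the empty label ε)
extended to words by concatenation (ε's disappear). -/
def obsW {T : Type*} {Λ : Type*} (ℓ : T → Option Λ) (w : List T) : List Λ :=
  w.filterMap ℓ

/-- A finite-state automaton (FSA) `S = (X, T, X₀, δ, Σ, ℓ)`:
states `X`, events `T`, initial states `init`, transition relation `trans`,
labels `Λ`, labelling function `lbl` (with `none` = ε, i.e. unobservable). -/
structure FSA (X : Type*) (T : Type*) (Λ : Type*) where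
  init : Set X
  trans : Set (X × T × X)
  lbl : T → Option Λ

namespace FSA

variable {X : Type*} {T : Type*} {Λ : Type*}

def step (A : FSA X T Λ) (x : X) (t : T) (y : X) : Prop := (x, t, y) ∈ A.trans

/-- extension of the transition relation to words. -/
def Run (A : FSA X T Λ) : X → List T → X → Prop := RunRel A.step

/-- `L(S)`: finite event sequences generated from initial states. -/
def Lang (A : FSA X T Λ) : Set (List T) := {w | ∃ x0 ∈ A.init, ∃ x, A.Run x0 w x}

def InfRun (A : FSA X T Λ) (x : ℕ → X) (s : ℕ → T) : Prop :=
  x 0 ∈ A.init ∧ ∀ n, A.step (x n) (s n) (x (n + 1))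

/-- `L^ω(S)`: infinite event sequences generated from initial states. -/
def LangW (A : FSA X T Λ) : Set (ℕ → T) := {s | ∃ x, A.InfRun x s}

/-- current-state estimate `M_O(S, σ)` under the observation map `O`. -/
def est (A : FSA X T Λ) (O : T → Option Λ) (σ : List Λ) : Set X :=
  {x | ∃ x0 ∈ A.init, ∃ w : List T, obsW O w = σ ∧ A.Run x0 w x}

/-- `y` is reachable from `x` (by a nonempty word). -/
def Reach (A : FSA X T Λ) (x y : X) : Prop := ∃ w : List T, w ≠ [] ∧ A.Run x w y

/-- `y` lies on a transition cycle. -/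
def OnCycle (A : FSA X T Λ) (y : X) : Prop := ∃ w : List T, w ≠ [] ∧ A.Run y w y

/-- the normal sub-automaton: all faulty transitions removed. -/
def normal (A : FSA X T Λ) (Tf : Set T) : FSA X T Λ :=
  ⟨A.init, {tr | tr ∈ A.trans ∧ tr.2.1 ∉ Tf}, A.lbl⟩

/-- local automaton: same data, re-labelled by a local observation map. -/
def localAut (A : FSA X T Λ) (O : T → Option Λ) : FSA X T Λ :=
  ⟨A.init, A.trans, O⟩

end FSA

/-- local observation map of an observer with observable event set `To`:
it sees the global label on events of `To` and nothing otherwise. -/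
noncomputable def localObs {T : Type*} {Λ : Type*} (ℓ : T → Option Λ) (To : Set T) :
    T → Option Λ :=
  fun t => @ite _ (t ∈ To) (Classical.propDecidable _) (ℓ t) none

/-- the first `n` events of an infinite event sequence. -/
def pre {T : Type*} (s : ℕ → T) (n : ℕ) : List T := (List.range n).map s

/-- `s ∈ T*T_f`: the word `s` ends with a faulty event. -/
def endsFaulty {T : Type*} (Tf : Set T) (s : List T) : Prop :=
  ∃ (s₁ : List T) (t : T), t ∈ Tf ∧ s = s₁ ++ [t]

/-- `T_f ∈ s`: the word `s` contains a faulty event. -/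
def hasFault {T : Type*} (Tf : Set T) (s : List T) : Prop := ∃ t ∈ s, t ∈ Tf

namespace FSA

variable {X : Type*} {T : Type*} {Λ : Type*} {L : ℕ}

/-- O-co-detectability (Definition CoDet). -/
def CoDetectable (A : FSA X T Λ) (O : Fin L → T → Option Λ) : Prop :=
  ∃ k : ℕ, ∀ s ∈ A.LangW, ∃ i : Fin L, ∀ n : ℕ,
    k ≤ (obsW (O i) (pre s n)).length →
    (A.est (O i) (obsW (O i) (pre s n))).ncard = 1

/-- strong detectability (Definition StrDet). -/
def StronglyDetectable (A : FSA X T Λ) : Prop :=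
  ∃ k : ℕ, ∀ s ∈ A.LangW, ∀ n : ℕ,
    k ≤ (obsW A.lbl (pre s n)).length →
    (A.est A.lbl (obsW A.lbl (pre s n))).ncard = 1

/-- (O, T_f)-co-diagnosability (Definition CoDiag). -/
def CoDiagnosable (A : FSA X T Λ) (O : Fin L → T → Option Λ) (Tf : Set T) : Prop :=
  ∃ k : ℕ, ∀ s s' : List T, s ∈ A.Lang → endsFaulty Tf s → s ++ s' ∈ A.Lang →
    k ≤ s'.length →
    ∃ i : Fin L, ∀ s'' ∈ A.Lang, obsW (O i) s'' = obsW (O i) (s ++ s') → hasFault Tf s''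

/-- T_f-diagnosability (Definition Diag). -/
def Diagnosable (A : FSA X T Λ) (Tf : Set T) : Prop :=
  ∃ k : ℕ, ∀ s s' : List T, s ∈ A.Lang → endsFaulty Tf s → s ++ s' ∈ A.Lang →
    k ≤ s'.length →
    ∀ s'' ∈ A.Lang, obsW A.lbl s'' = obsW A.lbl (s ++ s') → hasFault Tf s''

/-- (O, T_f)-co-predictability (Definition CoPred). -/
def CoPredictable (A : FSA X T Λ) (O : Fin L → T → Option Λ) (Tf : Set T) : Prop :=
  ∃ k : ℕ, ∀ s ∈ A.Lang, endsFaulty Tf s →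
    ∃ s' : List T, s' <+: s ∧ ¬ hasFault Tf s' ∧
      ∃ i : Fin L, ∀ u v : List T, u ++ v ∈ A.Lang → obsW (O i) s' = obsW (O i) u →
        ¬ hasFault Tf u → k ≤ v.length → hasFault Tf v

/-- T_f-predictability (Definition Pred). -/
def Predictable (A : FSA X T Λ) (Tf : Set T) : Prop :=
  ∃ k : ℕ, ∀ s ∈ A.Lang, endsFaulty Tf s →
    ∃ s' : List T, s' <+: s ∧ ¬ hasFault Tf s' ∧
      ∀ u v : List T, u ++ v ∈ A.Lang → obsW A.lbl s' = obsW A.lbl u →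
        ¬ hasFault Tf u → k ≤ v.length → hasFault Tf v

end FSA

section CC

variable {T : Type*} {Λ : Type*} {L : ℕ}

/-- labelling extended to `Option T` (with `none` = ε). -/
def obsE (ℓ : T → Option Λ) : Option T → Option Λ := fun t? => t?.bind ℓ

/-- one optional step: `none` = stay put, `some t` = take a `t`-transition. -/
def stepOpt {X : Type*} (tr : Set (X × T × X)) : X → Option T → X → Prop :=
  fun x t? y =>
    match t? with
    | none => x = y
    | some t => (x, t, y) ∈ tr

/-- validity of a composite event of the concurrent composition,
restricted to the "active" local components `act`. -/
def ccEventOn (ℓs : Fin L → T → Option Λ) (act : Fin L → Prop)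
    (t0 : Option T) (ts : Fin L → Option T) : Prop :=
  ((∀ j, act j → obsE (ℓs j) t0 = none) ∧
   (∀ j, act j → obsE (ℓs j) (ts j) = none) ∧
   ((t0 ≠ none ∧ ∀ j, act j → ts j = none) ∨
    (t0 = none ∧ ∃ j, act j ∧ ts j ≠ none ∧ ∀ j', act j' → j' ≠ j → ts j' = none)))
  ∨
  ((∃ j, act j ∧ obsE (ℓs j) t0 ≠ none) ∧
   (∀ l, act l →
     (obsE (ℓs l) t0 = none → ts l = none) ∧
     (obsE (ℓs l) t0 ≠ none → obsE (ℓs l) (ts l) = obsE (ℓs l) t0)))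

/-- validity of a composite event of the concurrent composition. -/
def ccEvent (ℓs : Fin L → T → Option Λ) (t0 : Option T) (ts : Fin L → Option T) : Prop :=
  ccEventOn ℓs (fun _ => True) t0 ts

/-- transition relation of the concurrent composition `CC_A(A0; A 0, …, A (L-1))`. -/
def ccTrans {X0 : Type*} {Xs : Fin L → Type*}
    (A0 : FSA X0 T Λ) (A : ∀ i, FSA (Xs i) T Λ) :
    (X0 × (∀ i, Xs i)) → (Option T × (Fin L → Option T)) → (X0 × (∀ i, Xs i)) → Prop :=
  fun p e q =>
    ccEvent (fun i => (A i).lbl) e.1 e.2 ∧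
    stepOpt A0.trans p.1 e.1 q.1 ∧
    ∀ i, stepOpt (A i).trans (p.2 i) (e.2 i) (q.2 i)

/-- initial states of the concurrent composition. -/
def ccInit {X0 : Type*} {Xs : Fin L → Type*}
    (A0 : FSA X0 T Λ) (A : ∀ i, FSA (Xs i) T Λ) : Set (X0 × (∀ i, Xs i)) :=
  {p | p.1 ∈ A0.init ∧ ∀ i, p.2 i ∈ (A i).init}

end CC

section Dia

/-- events of the ⋄-variant of the concurrent composition: ε, an event of `T`,
or the fresh event ⋄. -/
inductive DEv (T : Type*) where
  | eps : DEv T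
  | ev : T → DEv T
  | dia : DEv T

variable {X : Type*} {T : Type*} {Λ : Type*} {L : ℕ}

def devOf : Option T → DEv T
  | none => DEv.eps
  | some t => DEv.ev t

def devToOpt : DEv T → Option T
  | DEv.ev t => some t
  | _ => none

/-- transition relation of the variant concurrent composition
`CC_A^⋄(S; S_1, …, S_L)` of an FSA `A` with its local automata given by the
local observation maps `O i`.  A local component equal to `none` is the fresh
state ⋄. -/
def diaTrans (A : FSA X T Λ) (O : Fin L → T → Option Λ) :
    (X × (Fin L → Option X)) → (Option T × (Fin L → DEv T)) →
    (X × (Fin L → Option X)) → Prop :=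
  fun p e q =>
    -- an ordinary transition of the concurrent composition (all components in X)
    ((∃ ts : Fin L → Option T,
        (∀ i, e.2 i = devOf (ts i)) ∧
        ccEvent O e.1 ts ∧
        stepOpt A.trans p.1 e.1 q.1 ∧
        (∀ i, ∃ xi yi, p.2 i = some xi ∧ q.2 i = some yi ∧ stepOpt A.trans xi (ts i) yi)))
    ∨
    -- the extra ⋄-transitions, at states with some component differing from the 0-th
    ((∃ i, p.2 i ≠ some p.1) ∧
     (∀ i, p.2 i ≠ some p.1 → e.2 i = DEv.dia ∧ q.2 i = none) ∧
     (∃ ts : Fin L → Option T,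
        (∀ i, p.2 i = some p.1 → e.2 i = devOf (ts i)) ∧
        ((ccEventOn O (fun i => p.2 i = some p.1) e.1 ts ∧
          stepOpt A.trans p.1 e.1 q.1 ∧
          (∀ i, p.2 i = some p.1 → ∃ yi, q.2 i = some yi ∧ stepOpt A.trans p.1 (ts i) yi))
         ∨
         (e.1 = none ∧ q.1 = p.1 ∧
          (∀ i, p.2 i = some p.1 → ts i = none ∧ q.2 i = some p.1)))))

/-- initial states of the variant concurrent composition. -/
def diaInit (A : FSA X T Λ) : Set (X × (Fin L → Option X)) :=
  {p | p.1 ∈ A.init ∧ ∀ i, ∃ z ∈ A.init, p.2 i = some z}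

end Dia

/-- a (possibly partial) deterministic finite automaton. -/
structure PDFA (Q : Type*) (A : Type*) where
  start : Q
  accept : Set Q
  trans : Set (Q × A × Q)
  deterministic : ∀ q a q' q'', (q, a, q') ∈ trans → (q, a, q'') ∈ trans → q' = q''

namespace PDFA

variable {Q : Type*} {A : Type*}

def step (M : PDFA Q A) (q : Q) (a : A) (q' : Q) : Prop := (q, a, q') ∈ M.trans

def Accepts (M : PDFA Q A) (w : List A) : Prop :=
  ∃ q, RunRel M.step M.start w q ∧ q ∈ M.accept

def Acyclic (M : PDFA Q A) : Prop := ¬ ∃ (q : Q) (w : List A), w ≠ [] ∧ RunRel M.step q w q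

def Complete (M : PDFA Q A) : Prop := ∀ q a, ∃ q', (q, a, q') ∈ M.trans

def Deadlock (M : PDFA Q A) (q : Q) : Prop := ∀ a q', (q, a, q') ∉ M.trans

def DeadlockFree (M : PDFA Q A) : Prop := ∀ q, ∃ a q', (q, a, q') ∈ M.trans

end PDFA

end DES
namespace DES
namespace CoPredRed

variable {L : ℕ} {Alp : Type} {Q : Fin (L + 1) → Type}

/-- states: the (disjoint) states of `A_0, …, A_L` together with the fresh
states `⋄_0 = Sum.inr 0` and `⋄_1 = Sum.inr 1`. -/
abbrev St (Q : Fin (L + 1) → Type) : Type := (Σ i, Q i) ⊕ Fin 2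

/-- events: the renamed letters `σ_i = Sum.inl (i, σ)`, the fresh events
`a_i = Sum.inr (Sum.inl i)`, `a = Sum.inr (Sum.inr 0)` and the faulty event
`F = Sum.inr (Sum.inr 1)`. -/
abbrev Ev (L : ℕ) (Alp : Type) : Type := (Fin (L + 1) × Alp) ⊕ (Fin (L + 1) ⊕ Fin 2)

/-- labels: `Σ ∪ {a}` with the fresh label `a = Sum.inr ()`. -/
abbrev Lb (Alp : Type) : Type := Alp ⊕ Unit

/-- the labelling: `ℓ(σ_i) = σ`, `ℓ(a_i) = ℓ(a) = a`, `ℓ(F) = ε`. -/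
def lbl : Ev L Alp → Option (Lb Alp) :=
  fun e => match e with
    | Sum.inl (_, σ) => some (Sum.inl σ)
    | Sum.inr (Sum.inl _) => some (Sum.inr ())
    | Sum.inr (Sum.inr j) => if j = 0 then some (Sum.inr ()) else none

/-- the faulty event set `T_f = {F}`. -/
def Tf : Set (Ev L Alp) := {Sum.inr (Sum.inr 1)}

/-- the transition relation of the reduction FSA. -/
def trans (M : ∀ i, PDFA (Q i) Alp) : Set (St Q × Ev L Alp × St Q) :=
  {tr |
    -- from `⋄_0` to the former initial state of each `A_i`, labelled `a_i`
    (∃ i : Fin (L + 1),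
      tr = (Sum.inr 0, Sum.inr (Sum.inl i), Sum.inl ⟨i, (M i).start⟩)) ∨
    -- the renamed transitions inside each `A_i`
    (∃ (i : Fin (L + 1)) (σ : Alp) (q q' : Q i), (q, σ, q') ∈ (M i).trans ∧
      tr = (Sum.inl ⟨i, q⟩, Sum.inl (i, σ), Sum.inl ⟨i, q'⟩)) ∨
    -- from the (unique) accepting state of `A_0` to `⋄_1`, via the faulty event `F`
    (∃ q : Q 0, q ∈ (M 0).accept ∧
      tr = (Sum.inl ⟨0, q⟩, Sum.inr (Sum.inr 1), Sum.inr 1)) ∨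
    -- self-loop on `⋄_1`, via event `a`
    tr = (Sum.inr 1, Sum.inr (Sum.inr 0), Sum.inr 1)}

/-- the reduction FSA `S`, with unique initial state `⋄_0`. -/
def sys (M : ∀ i, PDFA (Q i) Alp) : FSA (St Q) (Ev L Alp) (Lb Alp) :=
  ⟨{Sum.inr 0}, trans M, lbl⟩

/-- observable event set of the observer in location `i ∈ [1, L]`
(location `i + 1` for `i : Fin L`): `Σ_0 ∪ Σ_i ∪ {a} ∪ {a_j : j ∈ [0, L]}`
(the faulty event `F` is not observed by any local observer). -/
def obsSet (i : Fin L) : Set (Ev L Alp) :=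
  {e | (∀ (j : Fin (L + 1)) (σ : Alp), e = Sum.inl (j, σ) → (j = 0 ∨ j = i.succ)) ∧
       (∀ j : Fin 2, e = Sum.inr (Sum.inr j) → j = 0)}

end CoPredRed
end DES

namespace DES
namespace CoPredRed

section Aux
variable {L : ℕ} {Alp : Type} {Q : Fin (L + 1) → Type}

theorem run_app {S E : Type*} {δ : S → E → S → Prop} {x y z : S} {u v : List E}
    (h : RunRel δ x u y) (h' : RunRel δ y v z) : RunRel δ x (u ++ v) z := by
  induction h with
  | nil x => exact h'
  | cons h1 _ ih => exact RunRel.cons h1 (ih h')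

theorem run_split {S E : Type*} {δ : S → E → S → Prop} {z : S} (u v : List E) :
    ∀ {x : S}, RunRel δ x (u ++ v) z → ∃ y, RunRel δ x u y ∧ RunRel δ y v z := by
  induction u with
  | nil => intro x h; exact ⟨x, RunRel.nil x, h⟩
  | cons e u ih =>
    intro x h
    cases h with
    | cons h1 h2 =>
      obtain ⟨y, hy, hy'⟩ := ih h2
      exact ⟨y, RunRel.cons h1 hy, hy'⟩

theorem run_det {Q' A : Type*} (M : PDFA Q' A) {x y : Q'} {w : List A}
    (h : RunRel M.step x w y) : ∀ {y'}, RunRel M.step x w y' → y = y' := by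
  induction h with
  | nil x => intro y' h'; cases h'; rfl
  | cons h1 _ ih =>
    intro y' h'
    cases h' with
    | cons h3 h4 =>
      have := M.deterministic _ _ _ _ h1 h3
      subst this
      exact ih h4

theorem run_long {Q' A : Type*} (M : PDFA Q' A) (h : M.DeadlockFree) (k : ℕ) :
    ∀ x, ∃ w y, w.length = k ∧ RunRel M.step x w y := by
  induction k with
  | zero => intro x; exact ⟨[], x, rfl, RunRel.nil x⟩
  | succ k ih =>
    intro x
    obtain ⟨a, y, hy⟩ := h x
    obtain ⟨w, z, hw, hz⟩ := ih y
    exact ⟨a :: w, z, by simp [hw], RunRel.cons hy hz⟩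

/-- rename a word into component `i`. -/
def ren (i : Fin (L + 1)) (w : List Alp) : List (Ev L Alp) := w.map fun σ => Sum.inl (i, σ)

theorem ren_noFault (i : Fin (L + 1)) (w : List Alp) : ¬ hasFault Tf (ren i w) := by
  rintro ⟨t, ht, ht'⟩
  simp only [ren, List.mem_map] at ht
  obtain ⟨σ, _, rfl⟩ := ht
  simp [Tf] at ht'

theorem ini_noFault (i : Fin (L + 1)) (w : List Alp) :
    ¬ hasFault Tf (Sum.inr (Sum.inl i) :: ren i w : List (Ev L Alp)) := by
  rintro ⟨t, ht, ht'⟩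
  rcases List.mem_cons.1 ht with rfl | ht
  · simp [Tf] at ht'
  · exact ren_noFault i w ⟨t, ht, ht'⟩

theorem step_inl (M : ∀ i, PDFA (Q i) Alp) {i : Fin (L + 1)} {q : Q i} {e : Ev L Alp} {y : St Q}
    (h : (sys M).step (Sum.inl ⟨i, q⟩) e y) :
    (∃ σ q', (M i).step q σ q' ∧ e = Sum.inl (i, σ) ∧ y = Sum.inl ⟨i, q'⟩) ∨
    (e = Sum.inr (Sum.inr 1) ∧ y = Sum.inr 1 ∧ i = 0 ∧ q ∈ (M i).accept) := by
  rcases h with ⟨j, h⟩ | ⟨j, σ, p, p', hp, h⟩ | ⟨p, hp, h⟩ | h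
  · simp at h
  · simp only [Prod.mk.injEq, Sum.inl.injEq] at h
    obtain ⟨h1, rfl, rfl⟩ := h
    cases h1
    exact Or.inl ⟨σ, p', hp, rfl, rfl⟩
  · simp only [Prod.mk.injEq, Sum.inl.injEq] at h
    obtain ⟨h1, rfl, rfl⟩ := h
    cases h1
    exact Or.inr ⟨rfl, rfl, rfl, hp⟩
  · simp at h

theorem step_init (M : ∀ i, PDFA (Q i) Alp) {e : Ev L Alp} {y : St Q}
    (h : (sys M).step (Sum.inr 0) e y) :
    ∃ i, e = Sum.inr (Sum.inl i) ∧ y = Sum.inl ⟨i, (M i).start⟩ := by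
  rcases h with ⟨j, h⟩ | ⟨j, σ, p, p', hp, h⟩ | ⟨p, hp, h⟩ | h
  · simp only [Prod.mk.injEq] at h
    exact ⟨j, h.2.1, h.2.2⟩
  · simp at h
  · simp at h
  · simp at h

theorem step_sink (M : ∀ i, PDFA (Q i) Alp) {e : Ev L Alp} {y : St Q}
    (h : (sys M).step (Sum.inr 1) e y) : e = Sum.inr (Sum.inr 0) ∧ y = Sum.inr 1 := by
  rcases h with ⟨j, h⟩ | ⟨j, σ, p, p', hp, h⟩ | ⟨p, hp, h⟩ | h
  · simp at h
  · simp at h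
  · simp at h
  · simp only [Prod.mk.injEq] at h
    exact ⟨h.2.1, h.2.2⟩

theorem run_sink (M : ∀ i, PDFA (Q i) Alp) (z : List (Ev L Alp)) {y : St Q}
    (h : RunRel (sys M).step (Sum.inr 1) z y) : y = Sum.inr 1 := by
  induction z with
  | nil => cases h; rfl
  | cons e z ih =>
    cases h with
    | cons h1 h2 =>
      obtain ⟨_, rfl⟩ := step_sink M h1
      exact ih h2

theorem run_comp (M : ∀ i, PDFA (Q i) Alp) {i : Fin (L + 1)} (z : List (Ev L Alp)) {y : St Q} :
    ∀ {q : Q i}, RunRel (sys M).step (Sum.inl ⟨i, q⟩) z y →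
    (¬ hasFault Tf z ∨ y ≠ Sum.inr 1) →
    ∃ w q', z = ren i w ∧ y = Sum.inl ⟨i, q'⟩ ∧ RunRel (M i).step q w q' := by
  induction z with
  | nil => intro q h _; cases h; exact ⟨[], q, rfl, rfl, RunRel.nil q⟩
  | cons e z ih =>
    intro q h hf
    cases h with
    | cons h1 h2 =>
      rcases step_inl M h1 with ⟨σ, q', hs, rfl, rfl⟩ | ⟨rfl, rfl, -, -⟩
      · obtain ⟨w, q'', rfl, hy, hr⟩ := ih h2 (hf.imp (fun hn ⟨t, ht, ht'⟩ =>
          hn ⟨t, List.mem_cons_of_mem _ ht, ht'⟩) id)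
        exact ⟨σ :: w, q'', rfl, hy, RunRel.cons hs hr⟩
      · rcases hf with hf | hf
        · exact absurd ⟨_, List.mem_cons_self, by simp [Tf]⟩ hf
        · exact absurd (run_sink M _ h2) hf

theorem run_ren (M : ∀ i, PDFA (Q i) Alp) {i : Fin (L + 1)} {q q' : Q i} {w : List Alp}
    (h : RunRel (M i).step q w q') :
    RunRel (sys M).step (Sum.inl ⟨i, q⟩) (ren i w) (Sum.inl ⟨i, q'⟩) := by
  induction h with
  | nil x => exact RunRel.nil _
  | cons h1 _ ih => exact RunRel.cons (Or.inr (Or.inl ⟨i, _, _, _, h1, rfl⟩)) ih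

theorem run_ini (M : ∀ i, PDFA (Q i) Alp) {i : Fin (L + 1)} {q' : Q i} {w : List Alp}
    (h : RunRel (M i).step (M i).start w q') :
    RunRel (sys M).step (Sum.inr 0) (Sum.inr (Sum.inl i) :: ren i w) (Sum.inl ⟨i, q'⟩) :=
  RunRel.cons (Or.inl ⟨i, rfl⟩) (run_ren M h)

theorem obs_ini (i : Fin L) (j : Fin (L + 1)) :
    localObs lbl (obsSet i) (Sum.inr (Sum.inl j) : Ev L Alp) = some (Sum.inr ()) := by
  simp [localObs, obsSet, lbl]

theorem obs_ren (i : Fin L) (j : Fin (L + 1)) (hj : j = 0 ∨ j = i.succ) (w : List Alp) :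
    obsW (localObs lbl (obsSet i)) (ren j w) = w.map Sum.inl := by
  have : ∀ σ : Alp, localObs lbl (obsSet i) (Sum.inl (j, σ) : Ev L Alp) = some (Sum.inl σ) := by
    intro σ
    simp only [localObs, lbl]
    rw [if_pos]
    refine ⟨?_, by simp⟩
    rintro j' σ' h
    cases h
    exact hj
  induction w with
  | nil => rfl
  | cons σ w ih =>
    simp only [obsW, ren, List.map_cons, List.filterMap_cons, this] at ih ⊢
    rw [ih]

theorem obs_ren' (i : Fin L) (j : Fin (L + 1)) (hj : ¬ (j = 0 ∨ j = i.succ)) (w : List Alp) :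
    obsW (localObs lbl (obsSet i)) (ren j w) = [] := by
  have : ∀ σ : Alp, localObs lbl (obsSet i) (Sum.inl (j, σ) : Ev L Alp) = none := by
    intro σ
    simp only [localObs]
    rw [if_neg]
    intro h
    exact hj (h.1 j σ rfl)
  induction w with
  | nil => rfl
  | cons σ w ih =>
    simp only [obsW, ren, List.map_cons, List.filterMap_cons, this] at ih ⊢
    rw [ih]

theorem obs_cons (i : Fin L) (j : Fin (L + 1)) (z : List (Ev L Alp)) :
    obsW (localObs lbl (obsSet i)) (Sum.inr (Sum.inl j) :: z) =
      Sum.inr () :: obsW (localObs lbl (obsSet i)) z := by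
  simp only [obsW, List.filterMap_cons, obs_ini]

theorem forward (M : ∀ i, PDFA (Q i) Alp)
    (hall : ∀ i, i ≠ 0 → (M i).DeadlockFree ∧ (M i).accept = Set.univ)
    (w : List Alp) (hw : ∀ i, (M i).Accepts w) :
    ¬ (sys M).CoPredictable (fun i : Fin L => localObs lbl (obsSet i)) Tf := by
  rintro ⟨k, hk⟩
  obtain ⟨q, hr, hq⟩ := hw 0
  obtain ⟨s', hp, hnf, i, hi⟩ := hk
    ((Sum.inr (Sum.inl 0) :: ren 0 w) ++ [Sum.inr (Sum.inr 1)])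
    ⟨Sum.inr 0, rfl, Sum.inr 1, run_app (run_ini M hr)
      (RunRel.cons (Or.inr (Or.inr (Or.inl ⟨q, hq, rfl⟩))) (RunRel.nil _))⟩
    ⟨_, _, rfl, rfl⟩
  have hp' : s' <+: Sum.inr (Sum.inl 0) :: ren 0 w := by
    rcases List.prefix_concat_iff.1 hp with h | h
    · exact absurd ⟨Sum.inr (Sum.inr 1), by simp [h], rfl⟩ hnf
    · exact h
  have hdf := (hall i.succ (Fin.succ_ne_zero i)).1
  rcases List.prefix_cons_iff.1 hp' with rfl | ⟨t, rfl, ht⟩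
  · obtain ⟨v, y, hv, hy⟩ := run_long _ hdf k (M i.succ).start
    exact ini_noFault i.succ v (hi [] (Sum.inr (Sum.inl i.succ) :: ren i.succ v)
      ⟨Sum.inr 0, rfl, _, run_ini M hy⟩ rfl (by simp [hasFault]) (by simp [ren]; omega))
  · obtain ⟨w', hw', rfl⟩ := List.prefix_map_iff.1 ht
    obtain ⟨w'', rfl⟩ := hw'
    obtain ⟨p, hp, -⟩ := hw i.succ
    obtain ⟨p', hp', -⟩ := run_split _ _ hp
    obtain ⟨v, y, hv, hy⟩ := run_long _ hdf k p'
    refine ren_noFault i.succ v (hi (Sum.inr (Sum.inl i.succ) :: ren i.succ w') (ren i.succ v)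
      ⟨Sum.inr 0, rfl, _, run_app (run_ini M hp') (run_ren M hy)⟩ ?_ (ini_noFault _ _)
      (by simp [ren]; omega))
    change obsW _ (_ :: ren 0 w') = _
    rw [obs_cons, obs_cons, obs_ren i 0 (Or.inl rfl), obs_ren i i.succ (Or.inr rfl)]

theorem backward (M : ∀ i, PDFA (Q i) Alp)
    (h0 : ∃ q, (M 0).accept = {q} ∧ (M 0).Deadlock q)
    (hall : ∀ i, i ≠ 0 → (M i).DeadlockFree ∧ (M i).accept = Set.univ)
    (hno : ¬ ∃ w : List Alp, ∀ i, (M i).Accepts w) :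
    (sys M).CoPredictable (fun i : Fin L => localObs lbl (obsSet i)) Tf := by
  refine ⟨1, ?_⟩
  rintro s ⟨x0, hx0, x, hx⟩ ⟨s₁, t, ht, rfl⟩
  obtain rfl : x0 = Sum.inr 0 := hx0
  obtain rfl : t = Sum.inr (Sum.inr 1) := ht
  obtain ⟨y, hy, hyx⟩ := run_split _ _ hx
  have hyF : ∃ q : Q 0, y = Sum.inl ⟨0, q⟩ ∧ q ∈ (M 0).accept := by
    cases hyx with
    | cons h1 _ =>
      rcases h1 with ⟨j, h⟩ | ⟨j, σ, p, p', hp, h⟩ | ⟨p, hp, h⟩ | h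
      · simp at h
      · simp at h
      · simp only [Prod.mk.injEq] at h
        exact ⟨p, h.1, hp⟩
      · simp at h
  obtain ⟨q, rfl, hq⟩ := hyF
  cases hy with
  | cons h1 h2 =>
  obtain ⟨j, rfl, rfl⟩ := step_init M h1
  obtain ⟨w, q', rfl, hqq, hr⟩ := run_comp M _ h2 (Or.inr (by simp))
  have := Sum.inl.inj hqq
  cases this
  have hex : ∃ i, ¬ (M i).Accepts w := by
    by_contra hcon
    push Not at hcon
    exact hno ⟨w, hcon⟩
  obtain ⟨i, hi⟩ := hex
  have hi0 : i ≠ 0 := by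
    rintro rfl
    exact hi ⟨q, hr, hq⟩
  obtain ⟨i, rfl⟩ := Fin.exists_succ_eq.2 hi0
  have hnr : ∀ p, ¬ RunRel (M i.succ).step (M i.succ).start w p := by
    intro p hp
    exact hi ⟨p, hp, by rw [(hall _ hi0).2]; trivial⟩
  refine ⟨_, List.prefix_append _ _, ini_noFault 0 w, i, ?_⟩
  rintro u v ⟨x0, hx0, x, hx⟩ hobs hnf hv
  obtain rfl : x0 = Sum.inr 0 := hx0
  rw [obs_cons, obs_ren i 0 (Or.inl rfl)] at hobs
  obtain ⟨y, hy, hyx⟩ := run_split _ _ hx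
  cases hy with
  | nil => simp [obsW] at hobs
  | cons g1 g2 =>
  obtain ⟨j, rfl, rfl⟩ := step_init M g1
  obtain ⟨w', p, rfl, rfl, hr'⟩ := run_comp M _ g2 (Or.inl (fun ⟨t, ht, ht'⟩ =>
    hnf ⟨t, List.mem_cons_of_mem _ ht, ht'⟩))
  rw [obs_cons] at hobs
  by_cases hj : j = 0 ∨ j = i.succ
  · rw [obs_ren i j hj] at hobs
    have hww : w = w' := List.map_injective_iff.2 Sum.inl_injective (List.cons.inj hobs).2
    subst hww
    rcases hj with rfl | rfl
    · have := run_det _ hr hr'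
      subst this
      obtain ⟨q0, hq0, hd⟩ := h0
      rw [hq0] at hq
      obtain rfl : q = q0 := hq
      cases hyx with
      | nil => simp at hv
      | cons k1 k2 =>
        rcases step_inl M k1 with ⟨σ, q', hs, -, -⟩ | ⟨rfl, -, -, -⟩
        · exact absurd hs (hd _ _)
        · exact ⟨_, List.mem_cons_self, rfl⟩
    · exact absurd hr' (hnr p)
  · rw [obs_ren' i j hj] at hobs
    have : w = [] := by simpa using hobs
    subst this
    exact absurd (RunRel.nil _) (hnr _)

end Aux
end CoPredRed
end DES

open DES in
/-- Theorem (reduction): for DFAs `A_0, …, A_L` over a common alphabet such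
that `A_0` has exactly one accepting state which is deadlock, and each `A_i`
(`i ∈ [1, L]`) is deadlock-free with all states accepting, some word is
accepted by every `A_i` iff the constructed deterministic deadlock-free FSA
`S` is not (O, T_f)-co-predictable. -/
theorem dfa_intersection_iff_not_coPredictable
    {L : ℕ} (hL : 0 < L) {Alp : Type} {Q : Fin (L + 1) → Type}
    [Fintype Alp] [∀ i, Fintype (Q i)]
    (M : ∀ i, PDFA (Q i) Alp)
    (h0 : ∃ q, (M 0).accept = {q} ∧ (M 0).Deadlock q)
    (hall : ∀ i, i ≠ 0 → (M i).DeadlockFree ∧ (M i).accept = Set.univ) :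
    (∃ w : List Alp, ∀ i, (M i).Accepts w) ↔
    ¬ (CoPredRed.sys M).CoPredictable
        (fun i : Fin L => localObs CoPredRed.lbl (CoPredRed.obsSet i))
        CoPredRed.Tf := by
  constructor
  · rintro ⟨w, hw⟩
    exact CoPredRed.forward M hall w hw
  · intro h
    by_contra hno
    exact h (CoPredRed.backward M h0 hall hno)
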